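/- Suppose char(F_q) ≠ 3. There is an absolute constant C > 0, independent of q and N, such that for every monic N ∈ F_q[t], Σ_{k ∈ O, |k| < |N|} 1/ρ̃(N,k) ≤ C·|N|, where the sum is over all polynomials k of degree less than deg N (including k = 0). -/

import Mathlib

open Polynomial

/-- The normalised local density
`ρ̃(N,k) = |N|^{−2}·#{(x,y,z) ∈ (O/NO)³ : x³ + y³ + z³ ≡ k (mod N)}`. -/
noncomputable def rhoTilde (Fq : Type) [Field Fq] [Fintype Fq] (N k : Polynomial Fq) : ℝ :=
  (Nat.card {v : (Polynomial Fq ⧸ Ideal.span {N}) × (Polynomial Fq ⧸ Ideal.span {N}) ×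
      (Polynomial Fq ⧸ Ideal.span {N}) //
      v.1 ^ 3 + v.2.1 ^ 3 + v.2.2 ^ 3 = Ideal.Quotient.mk (Ideal.span {N}) k} : ℝ) /
    ((Fintype.card Fq : ℝ) ^ N.natDegree) ^ 2

section FieldPart
open Finset

lemma parseval_count {K T : Type} [Field K] [Fintype K] [DecidableEq K] [Fintype T] (f : T → K) :
    ∑ ψ : AddChar K ℂ, ‖∑ t, ψ (f t)‖ ^ 2 =
      (Fintype.card K : ℝ) * ∑ k : K, ((univ.filter fun t => f t = k).card : ℝ) ^ 2 := by
  have h1 : ∀ ψ : AddChar K ℂ, ((‖∑ t, ψ (f t)‖ ^ 2 : ℝ) : ℂ) = ∑ s, ∑ t, ψ (f s - f t) := by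
    intro ψ
    rw [← Complex.normSq_eq_norm_sq, ← Complex.mul_conj, map_sum, Finset.sum_mul_sum]
    refine Finset.sum_congr rfl fun s _ => Finset.sum_congr rfl fun t _ => ?_
    rw [sub_eq_add_neg, AddChar.map_add_eq_mul, AddChar.map_neg_eq_conj]
  have h2 : ((∑ ψ : AddChar K ℂ, ‖∑ t, ψ (f t)‖ ^ 2 : ℝ) : ℂ) =
      (((Fintype.card K : ℝ) * ∑ k : K, ((univ.filter fun t => f t = k).card : ℝ) ^ 2 : ℝ) : ℂ) := by
    rw [Complex.ofReal_sum]
    simp_rw [h1]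
    rw [Finset.sum_comm]
    have h3 : ∀ s : T, ∑ ψ : AddChar K ℂ, ∑ t, ψ (f s - f t) =
        (Fintype.card K : ℂ) * ((univ.filter fun t => f t = f s).card : ℂ) := by
      intro s
      rw [Finset.sum_comm]
      simp_rw [AddChar.sum_apply_eq_ite]
      rw [Finset.card_filter]
      push_cast
      rw [Finset.mul_sum]
      refine Finset.sum_congr rfl fun t _ => ?_
      by_cases h : f t = f s
      · simp [h]
      · simp [h, sub_eq_zero, Ne.symm h]
    simp_rw [h3]
    rw [← Finset.mul_sum]
    push_cast
    congr 1
    rw [← Finset.sum_fiberwise univ f]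
    refine Finset.sum_congr rfl fun k _ => ?_
    rw [Finset.sum_congr rfl (g := fun _ => ((univ.filter fun t => f t = k).card : ℂ))]
    · simp [sq]
    · intro s hs
      simp only [mem_filter] at hs
      rw [hs.2]
  exact_mod_cast h2

lemma card_cube_le {K : Type} [Field K] [Fintype K] [DecidableEq K] (k : K) :
    (univ.filter fun x : K => x ^ 3 = k).card ≤ 3 := by
  have h : (univ.filter fun x : K => x ^ 3 = k) ⊆ (nthRoots 3 k).toFinset := by
    intro x hx
    simp only [mem_filter] at hx
    simp [mem_nthRoots, hx.2]
  exact (card_le_card h).trans ((Multiset.toFinset_card_le _).trans (card_nthRoots 3 k))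

/-- orbit trick: a function of nonzero elements invariant under cubes. -/
lemma orbit_bound {K A : Type} [Field K] [Fintype K] [DecidableEq K] [Fintype A] [DecidableEq A]
    (F : A → ℝ) (hF : ∀ a, 0 ≤ F a) (s : Finset A) (act : K → A) (hact : Function.Injective act)
    (hs : ∀ c, c ≠ 0 → act c ∈ s) (c0 : ℝ) (hinv : ∀ c : K, c ≠ 0 → F (act (c ^ 3)) = c0) :
    ((Fintype.card K : ℝ) - 1) * c0 ≤ 3 * ∑ a ∈ s, F a := by
  have h1 : ((Fintype.card K : ℝ) - 1) * c0 = ∑ c ∈ univ.erase (0 : K), F (act (c ^ 3)) := by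
    rw [Finset.sum_congr rfl (g := fun _ => c0)]
    · rw [sum_const, card_erase_of_mem (mem_univ _), nsmul_eq_mul, card_univ,
        Nat.cast_sub Fintype.card_pos]
      simp
    · intro c hc
      exact hinv c (ne_of_mem_erase hc)
  rw [h1, mul_sum]
  rw [← Finset.sum_fiberwise_of_maps_to (t := s) (g := fun c : K => act (c ^ 3))]
  · refine sum_le_sum fun a _ => ?_
    rw [Finset.sum_congr rfl (g := fun _ => F a)]
    · rw [sum_const, nsmul_eq_mul]
      refine mul_le_mul_of_nonneg_right ?_ (hF a)
      by_cases hk : ∃ k, act k = a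
      · obtain ⟨k, rfl⟩ := hk
        have : ((univ.erase (0 : K)).filter fun c => act (c ^ 3) = act k) ⊆
            univ.filter fun c : K => c ^ 3 = k := by
          intro c hc
          simp only [mem_filter] at hc
          simpa using hact hc.2
        exact_mod_cast (card_le_card this).trans (card_cube_le k)
      · rw [filter_false_of_mem]
        · simp
        · intro c _ h
          exact hk ⟨_, h⟩
    · intro c hc
      simp only [mem_filter] at hc
      rw [hc.2]
  · intro c hc
    exact hs _ (pow_ne_zero 3 (ne_of_mem_erase hc))

lemma two_le_card {K : Type} [Field K] [Fintype K] : (2 : ℝ) ≤ Fintype.card K := by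
  exact_mod_cast Fintype.one_lt_card (α := K)

lemma cube_sum_sq {K : Type} [Field K] [Fintype K] [DecidableEq K] :
    ∑ ψ ∈ univ.erase (0 : AddChar K ℂ), ‖∑ x : K, ψ (x ^ 3)‖ ^ 2 ≤ 2 * (Fintype.card K : ℝ) ^ 2 := by
  have h := parseval_count (fun x : K => x ^ 3)
  have h0 := Finset.add_sum_erase univ (fun ψ : AddChar K ℂ => ‖∑ x : K, ψ (x ^ 3)‖ ^ 2)
    (mem_univ (0 : AddChar K ℂ))
  have h1 : ∑ k : K, ((univ.filter fun x : K => x ^ 3 = k).card : ℝ) ^ 2 ≤ 3 * Fintype.card K := by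
    have h2 : ∑ k : K, ((univ.filter fun x : K => x ^ 3 = k).card : ℝ) = Fintype.card K := by
      have := Finset.card_eq_sum_card_fiberwise (f := fun x : K => x ^ 3) (s := univ) (t := univ)
        (by simp)
      rw [card_univ] at this
      rw [this]
      push_cast
      rfl
    rw [← h2, mul_sum]
    refine sum_le_sum fun k _ => ?_
    have := card_cube_le k
    have h3 : ((univ.filter fun x : K => x ^ 3 = k).card : ℝ) ≤ 3 := by exact_mod_cast this
    have h4 : (0 : ℝ) ≤ ((univ.filter fun x : K => x ^ 3 = k).card : ℝ) := by positivity
    nlinarith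
  simp only [AddChar.zero_apply, sum_const, card_univ, nsmul_eq_mul, mul_one, Complex.norm_natCast]
    at h0
  have h5 := mul_le_mul_of_nonneg_left h1 (Nat.cast_nonneg (α := ℝ) (Fintype.card K))
  nlinarith

lemma cube_sum_bound {K : Type} [Field K] [Fintype K] [DecidableEq K] (ψ : AddChar K ℂ)
    (hψ : ψ ≠ 0) : ‖∑ x : K, ψ (x ^ 3)‖ ^ 2 ≤ 12 * (Fintype.card K : ℝ) := by
  have hp : ψ.IsPrimitive := AddChar.IsPrimitive.of_ne_one hψ
  have hinj := AddChar.to_mulShift_inj_of_isPrimitive hp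
  have h := orbit_bound (K := K) (fun χ : AddChar K ℂ => ‖∑ x : K, χ (x ^ 3)‖ ^ 2)
    (fun _ => by positivity) (univ.erase 0) (fun c => ψ.mulShift c) hinj
    (fun c hc => by
      rw [mem_erase]
      exact ⟨fun h => hp hc h, mem_univ _⟩) (‖∑ x : K, ψ (x ^ 3)‖ ^ 2) (by
      intro c hc
      simp only [AddChar.mulShift_apply]
      congr 2
      exact Fintype.sum_equiv (Equiv.mulLeft₀ c hc) _ _ (fun x => by simp [mul_pow]))
  have h2 := cube_sum_sq (K := K)
  have h3 := two_le_card (K := K)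
  set Q := (Fintype.card K : ℝ)
  set s := ‖∑ x : K, ψ (x ^ 3)‖ ^ 2
  have : (Q - 1) * s ≤ 6 * Q ^ 2 := by linarith
  by_contra hc
  push Not at hc
  nlinarith

lemma second_moment {K : Type} [Field K] [Fintype K] [DecidableEq K] :
    ∑ k : K, ((univ.filter fun v : K × K × K => v.1 ^ 3 + v.2.1 ^ 3 + v.2.2 ^ 3 = k).card : ℝ) ^ 2
      ≤ (Fintype.card K : ℝ) ^ 5 + 288 * (Fintype.card K : ℝ) ^ 3 := by
  have h := parseval_count (fun v : K × K × K => v.1 ^ 3 + v.2.1 ^ 3 + v.2.2 ^ 3)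
  have h1 : ∀ ψ : AddChar K ℂ, ‖∑ v : K × K × K, ψ (v.1 ^ 3 + v.2.1 ^ 3 + v.2.2 ^ 3)‖ ^ 2 =
      (‖∑ x : K, ψ (x ^ 3)‖ ^ 2) ^ 3 := by
    intro ψ
    have h : ∑ v : K × K × K, ψ (v.1 ^ 3 + v.2.1 ^ 3 + v.2.2 ^ 3) = (∑ x : K, ψ (x ^ 3)) ^ 3 := by
      simp_rw [AddChar.map_add_eq_mul, Fintype.sum_prod_type, ← Finset.mul_sum, ← Finset.sum_mul]
      simp_rw [← Finset.mul_sum, ← Finset.sum_mul]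
      ring
    rw [h, norm_pow]
    ring
  simp_rw [h1] at h
  have h0 := Finset.add_sum_erase univ (fun ψ : AddChar K ℂ => (‖∑ x : K, ψ (x ^ 3)‖ ^ 2) ^ 3)
    (mem_univ (0 : AddChar K ℂ))
  simp only [AddChar.zero_apply, sum_const, card_univ, nsmul_eq_mul, mul_one, Complex.norm_natCast]
    at h0
  have h2 : ∑ ψ ∈ univ.erase (0 : AddChar K ℂ), (‖∑ x : K, ψ (x ^ 3)‖ ^ 2) ^ 3 ≤
      (12 * (Fintype.card K : ℝ)) ^ 2 * (2 * (Fintype.card K : ℝ) ^ 2) := by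
    refine le_trans ?_ (mul_le_mul_of_nonneg_left (cube_sum_sq (K := K)) (by positivity))
    rw [mul_sum]
    refine sum_le_sum fun ψ hψ => ?_
    have := cube_sum_bound ψ (ne_of_mem_erase hψ)
    rw [pow_succ]
    refine mul_le_mul_of_nonneg_right ?_ (by positivity)
    gcongr
  have h3 := two_le_card (K := K)
  rw [← h0] at h
  set Q := (Fintype.card K : ℝ)
  set M := ∑ k : K, ((univ.filter fun v : K × K × K =>
    v.1 ^ 3 + v.2.1 ^ 3 + v.2.2 ^ 3 = k).card : ℝ) ^ 2
  have h4 : Q * M ≤ Q * (Q ^ 5 + 288 * Q ^ 3) := by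
    rw [← h]; nlinarith
  exact le_of_mul_le_mul_left h4 (by linarith)


lemma field_bound {K : Type} [Field K] [Fintype K] [DecidableEq K] (n : K → ℕ)
    (hn : ∀ k, n k = (univ.filter fun v : K × K × K =>
      v ≠ 0 ∧ v.1 ^ 3 + v.2.1 ^ 3 + v.2.2 ^ 3 = k).card) :
    ∑ k : K, (Fintype.card K : ℝ) / n k ≤ 1 + 1200 ^ 4 / (Fintype.card K : ℝ) ^ 2 := by
  have h2 := two_le_card (K := K)
  have hsum : ∑ k : K, (n k : ℝ) = (Fintype.card K : ℝ) ^ 3 - 1 := by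
    have := Finset.card_eq_sum_card_fiberwise
      (f := fun v : K × K × K => v.1 ^ 3 + v.2.1 ^ 3 + v.2.2 ^ 3)
      (s := univ.erase 0) (t := univ) (by simp)
    rw [card_erase_of_mem (mem_univ _), card_univ, Fintype.card_prod, Fintype.card_prod] at this
    have h3 : ∑ k : K, n k = ∑ b : K, ((univ.erase (0 : K × K × K)).filter
        fun v => v.1 ^ 3 + v.2.1 ^ 3 + v.2.2 ^ 3 = b).card := by
      refine sum_congr rfl fun k _ => ?_
      rw [hn k]
      congr 1
      ext v
      simp
    rw [← h3] at this
    have hpos : 1 ≤ Fintype.card K * (Fintype.card K * Fintype.card K) :=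
      Nat.succ_le_of_lt (by have := Fintype.card_pos (α := K); positivity)
    have h4 : ((Fintype.card K * (Fintype.card K * Fintype.card K) - 1 : ℕ) : ℝ) =
      ((∑ k : K, n k : ℕ) : ℝ) := by rw [this]
    rw [Nat.cast_sub hpos] at h4
    push_cast at h4
    rw [← h4]
    ring
  have hsq : ∑ k : K, (n k : ℝ) ^ 2 ≤ (Fintype.card K : ℝ) ^ 5 + 288 * (Fintype.card K : ℝ) ^ 3 := by
    refine le_trans (sum_le_sum fun k _ => ?_) (second_moment (K := K))
    rw [hn k]
    gcongr
    exact fun h => h.2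
  have hinv : ∀ k c : K, c ≠ 0 → n (k * c ^ 3) = n k := by
    intro k c hc
    rw [hn, hn]
    symm
    refine Finset.card_bij (fun v _ => (c * v.1, c * v.2.1, c * v.2.2)) ?_ ?_ ?_
    · rintro ⟨x, y, z⟩ hv
      simp only [mem_filter, mem_univ, true_and, ne_eq, Prod.mk_eq_zero, mul_eq_zero, hc,
        false_or] at hv ⊢
      refine ⟨hv.1, ?_⟩
      rw [← hv.2]
      ring
    · rintro ⟨x, y, z⟩ _ ⟨x', y', z'⟩ _ h
      simpa [hc] using h
    · rintro ⟨x, y, z⟩ hv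
      simp only [mem_filter, mem_univ, true_and, ne_eq, Prod.mk_eq_zero] at hv
      refine ⟨(c⁻¹ * x, c⁻¹ * y, c⁻¹ * z), ?_, ?_⟩
      · simp only [mem_filter, mem_univ, true_and, ne_eq, Prod.mk_eq_zero, mul_eq_zero,
          inv_eq_zero, hc, false_or]
        refine ⟨hv.1, ?_⟩
        rw [mul_pow, mul_pow, mul_pow, ← mul_add, ← mul_add, hv.2]
        field_simp
      · simp [hc]
  set Q := (Fintype.card K : ℝ) with hQ
  by_cases hbig : 1200 ≤ Q
  · set r : K → ℝ := fun k => (n k : ℝ) / Q ^ 2 with hr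
    have hrs : ∑ k, r k = Q - 1 / Q ^ 2 := by
      simp only [hr]
      rw [← sum_div, hsum]
      field_simp
    have hrq : ∑ k, r k ^ 2 ≤ Q + 288 / Q := by
      simp only [hr, div_pow]
      rw [← sum_div, div_le_iff₀ (by positivity)]
      refine hsq.trans (le_of_eq ?_)
      field_simp
    have hvar : ∑ k, (r k - 1) ^ 2 ≤ 289 / Q := by
      have : ∑ k, (r k - 1) ^ 2 = ∑ k, r k ^ 2 - 2 * ∑ k, r k + Q := by
        simp only [sub_sq, sum_add_distrib, sum_sub_distrib, mul_sum]
        simp [hQ]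
      rw [this, hrs]
      have h1 : 2 * (1 / Q ^ 2) ≤ 1 / Q := by
        rw [← mul_div_assoc, div_le_div_iff₀ (by positivity) (by positivity)]
        nlinarith
      have h3 : 289 / Q = 288 / Q + 1 / Q := by ring
      linarith
    have hlow : ∀ k, (r k - 1) ^ 2 ≤ 1 / 4 := by
      intro k
      by_cases hk : k = 0
      · have := single_le_sum (f := fun k => (r k - 1) ^ 2) (fun _ _ => sq_nonneg _) (mem_univ k)
        refine (this.trans hvar).trans ?_
        rw [div_le_div_iff₀ (by positivity) (by positivity)]
        linarith
      · have := orbit_bound (K := K) (fun k => (r k - 1) ^ 2) (fun _ => sq_nonneg _) univ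
          (fun c => k * c) (mul_right_injective₀ hk) (fun _ _ => mem_univ _) ((r k - 1) ^ 2)
          (fun c hc => by simp only [hr, hinv k c hc])
        have h3 : 289 / Q ≤ 1 := by
          rw [div_le_one (by positivity)]; linarith
        have h4 : (Q - 1) * (r k - 1) ^ 2 ≤ 3 := by linarith
        nlinarith [sq_nonneg (r k - 1)]
    have hpt : ∀ k, Q / n k ≤ (1 / Q) * (2 - r k + 2 * (r k - 1) ^ 2) := by
      intro k
      have h1 : 1 / 2 ≤ r k := by nlinarith [hlow k]
      have h3 : Q / n k = (1 / Q) * (1 / r k) := by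
        simp only [hr]
        field_simp
      rw [h3]
      refine mul_le_mul_of_nonneg_left ?_ (by positivity)
      rw [div_le_iff₀ (by linarith)]
      nlinarith [mul_nonneg (sq_nonneg (r k - 1)) (by linarith : 0 ≤ 2 * r k - 1)]
    refine (sum_le_sum fun k _ => hpt k).trans ?_
    rw [← mul_sum, sum_add_distrib, sum_sub_distrib, ← mul_sum, hrs]
    simp only [sum_const, card_univ, nsmul_eq_mul]
    rw [← hQ]
    have h5 : 1 / Q ^ 2 ≤ 1 / Q := by
      apply one_div_le_one_div_of_le (by positivity); nlinarith
    have h6 : Q * 2 - (Q - 1 / Q ^ 2) + 2 * ∑ k, (r k - 1) ^ 2 ≤ Q + 579 / Q := by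
      have h7 : 579 / Q = 1 / Q + 2 * (289 / Q) := by ring
      linarith
    refine (mul_le_mul_of_nonneg_left h6 (by positivity)).trans ?_
    have h8 : 1 / Q * (Q + 579 / Q) = 1 + 579 / Q ^ 2 := by field_simp
    rw [h8]
    gcongr
    norm_num
  · push Not at hbig
    have hpt : ∀ k, Q / n k ≤ Q := by
      intro k
      rcases Nat.eq_zero_or_pos (n k) with h | h
      · rw [h]; simp; linarith
      · exact div_le_self (by linarith) (by exact_mod_cast h)
    refine (sum_le_sum fun k _ => hpt k).trans ?_
    simp only [sum_const, card_univ, nsmul_eq_mul]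
    rw [← hQ]
    have : Q * Q ≤ 1200 ^ 4 / Q ^ 2 := by
      rw [le_div_iff₀ (by positivity)]
      calc Q * Q * Q ^ 2 = Q ^ 4 := by ring
        _ ≤ 1200 ^ 4 := by gcongr
    linarith

end FieldPart

noncomputable def cnt (R : Type) [CommRing R] (k : R) : ℕ :=
  Nat.card {v : R × R × R // v.1 ^ 3 + v.2.1 ^ 3 + v.2.2 ^ 3 = k}

noncomputable def GG (R : Type) [CommRing R] : ℝ :=
  ∑ᶠ k : R, (Nat.card R : ℝ) / cnt R k

section LocalPart

lemma cube_root_lift {R K : Type} [CommRing R] [Finite R] [Field K] (φ : R →+* K)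
    (hφ : Function.Surjective φ) (hloc : ∀ x, φ x ≠ 0 → IsUnit x) (h3 : (3 : K) ≠ 0)
    (a : K) (ha : a ≠ 0) (w : R) (hw : φ w = a ^ 3) : ∃ x, φ x = a ∧ x ^ 3 = w := by
  obtain ⟨s, hs⟩ := hφ.hasRightInverse
  let e : {x // φ x = a} ≃ {x // φ x = a ^ 3} :=
    { toFun := fun x => ⟨x.1 + (s (a ^ 3) - s a), by simp [x.2, hs _]⟩
      invFun := fun x => ⟨x.1 - (s (a ^ 3) - s a), by simp [x.2, hs _]⟩
      left_inv := fun x => by simp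
      right_inv := fun x => by simp }
  let f : {x // φ x = a} → {x // φ x = a ^ 3} := fun x => ⟨x.1 ^ 3, by simp [x.2]⟩
  have hf : Function.Injective f := by
    rintro ⟨x, hx⟩ ⟨y, hy⟩ h
    have h1 : x ^ 3 = y ^ 3 := congrArg Subtype.val h
    have hu : IsUnit (x ^ 2 + x * y + y ^ 2) := by
      apply hloc
      have : φ (x ^ 2 + x * y + y ^ 2) = 3 * a ^ 2 := by
        simp only [map_add, map_mul, map_pow, hx, hy]; ring
      rw [this]
      exact mul_ne_zero h3 (pow_ne_zero 2 ha)
    have h2 : (x ^ 2 + x * y + y ^ 2) * (x - y) = 0 := by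
      linear_combination h1
    rw [hu.mul_right_eq_zero, sub_eq_zero] at h2
    exact Subtype.ext h2
  obtain ⟨⟨x, hx⟩, h⟩ := (Finite.injective_iff_surjective_of_equiv e).1 hf ⟨w, hw⟩
  exact ⟨x, hx, congrArg Subtype.val h⟩

lemma fiber_count {R K : Type} [CommRing R] [Finite R] [Field K] (φ : R →+* K)
    (hφ : Function.Surjective φ) (hloc : ∀ x, φ x ≠ 0 → IsUnit x) (h3 : (3 : K) ≠ 0) (k : R) :
    Nat.card {v : K × K × K // v ≠ 0 ∧ v.1 ^ 3 + v.2.1 ^ 3 + v.2.2 ^ 3 = φ k} *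
      (Nat.card {x : R // φ x = 0}) ^ 2 ≤ cnt R k := by
  classical
  obtain ⟨s, hs⟩ := hφ.hasRightInverse
  choose g hg1 hg2 using cube_root_lift φ hφ hloc h3
  have key : ∀ (v : K × K × K) (m n : R), v ≠ 0 → v.1 ^ 3 + v.2.1 ^ 3 + v.2.2 ^ 3 = φ k →
      φ m = 0 → φ n = 0 → ∃ u : R × R × R, u.1 ^ 3 + u.2.1 ^ 3 + u.2.2 ^ 3 = k ∧
        φ u.1 = v.1 ∧ φ u.2.1 = v.2.1 ∧ φ u.2.2 = v.2.2 ∧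
        (if v.1 ≠ 0 then m = u.2.1 - s v.2.1 ∧ n = u.2.2 - s v.2.2 else
          if v.2.1 ≠ 0 then m = u.1 - s v.1 ∧ n = u.2.2 - s v.2.2 else
          m = u.1 - s v.1 ∧ n = u.2.1 - s v.2.1) := by
    rintro ⟨a, b, c⟩ m n hv hk hm hn
    simp only at hk ⊢
    by_cases ha : a ≠ 0
    · obtain ⟨x, hx, hx3⟩ := cube_root_lift φ hφ hloc h3 a ha
        (k - (s b + m) ^ 3 - (s c + n) ^ 3) (by
          simp only [map_sub, map_pow, map_add, hs _, hm, hn, ← hk]; ring)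
      refine ⟨(x, s b + m, s c + n), ?_, hx, ?_, ?_, ?_⟩
      · simp only [hx3]; ring
      · simp [hs _, hm]
      · simp [hs _, hn]
      · simp [ha]
    by_cases hb : b ≠ 0
    · obtain ⟨x, hx, hx3⟩ := cube_root_lift φ hφ hloc h3 b hb
        (k - (s a + m) ^ 3 - (s c + n) ^ 3) (by
          simp only [map_sub, map_pow, map_add, hs _, hm, hn, ← hk]; ring)
      refine ⟨(s a + m, x, s c + n), ?_, ?_, hx, ?_, ?_⟩
      · simp only [hx3]; ring
      · simp [hs _, hm]
      · simp [hs _, hn]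
      · rw [if_neg ha, if_pos hb]; simp
    have hc : c ≠ 0 := by
      push Not at ha hb
      rintro rfl
      exact hv (by simp [ha, hb])
    · obtain ⟨x, hx, hx3⟩ := cube_root_lift φ hφ hloc h3 c hc
        (k - (s a + m) ^ 3 - (s b + n) ^ 3) (by
          simp only [map_sub, map_pow, map_add, hs _, hm, hn, ← hk]; ring)
      refine ⟨(s a + m, s b + n, x), ?_, ?_, ?_, hx, ?_⟩
      · simp only [hx3]; ring
      · simp [hs _, hm]
      · simp [hs _, hn]
      · rw [if_neg ha, if_neg hb]; simp
  choose! G hG1 hG2 hG3 hG4 hG5 using key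
  rw [sq, ← Nat.card_prod, ← Nat.card_prod]
  refine Nat.card_le_card_of_injective (β := {v : R × R × R // v.1 ^ 3 + v.2.1 ^ 3 + v.2.2 ^ 3 = k})
    (fun t => ⟨G t.1.1 t.2.1.1 t.2.2.1,
      hG1 _ _ _ t.1.2.1 t.1.2.2 t.2.1.2 t.2.2.2⟩) ?_
  rintro ⟨⟨v, hv, hvk⟩, ⟨m, hm⟩, ⟨n, hn⟩⟩ ⟨⟨v', hv', hvk'⟩, ⟨m', hm'⟩, ⟨n', hn'⟩⟩ h
  have h : G v m n = G v' m' n' := congrArg Subtype.val h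
  have hvv : v = v' := by
    refine Prod.ext ?_ (Prod.ext ?_ ?_)
    · rw [← hG2 v m n hv hvk hm hn, h, hG2 v' m' n' hv' hvk' hm' hn']
    · rw [← hG3 v m n hv hvk hm hn, h, hG3 v' m' n' hv' hvk' hm' hn']
    · rw [← hG4 v m n hv hvk hm hn, h, hG4 v' m' n' hv' hvk' hm' hn']
  subst hvv
  have e1 := hG5 v m n hv hvk hm hn
  have e2 := hG5 v m' n' hv' hvk' hm' hn'
  rw [h] at e1
  have : m = m' ∧ n = n' := by
    split_ifs at e1 e2 <;> exact ⟨e1.1.trans e2.1.symm, e1.2.trans e2.2.symm⟩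
  obtain ⟨rfl, rfl⟩ := this
  rfl

lemma local_bound {R K : Type} [CommRing R] [Finite R] [Field K] (φ : R →+* K)
    (hφ : Function.Surjective φ) (hloc : ∀ x, φ x ≠ 0 → IsUnit x) (h3 : (3 : K) ≠ 0) :
    GG R ≤ 1 + 1200 ^ 4 / (Nat.card K : ℝ) ^ 2 := by
  classical
  have : Finite K := Finite.of_surjective φ hφ
  have := Fintype.ofFinite R
  have := Fintype.ofFinite K
  obtain ⟨s, hs⟩ := hφ.hasRightInverse
  let e : R ≃ K × {x : R // φ x = 0} :=
    { toFun := fun x => (φ x, ⟨x - s (φ x), by simp [hs _]⟩)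
      invFun := fun x => s x.1 + x.2.1
      left_inv := fun x => by simp
      right_inv := fun x => by
        obtain ⟨a, m, hm⟩ := x
        simp [hs _, hm] }
  set n : K → ℕ := fun κ => (Finset.univ.filter fun v : K × K × K =>
      v ≠ 0 ∧ v.1 ^ 3 + v.2.1 ^ 3 + v.2.2 ^ 3 = κ).card with hn
  have hmain := field_bound n (fun _ => rfl)
  have hcard : (Nat.card R : ℝ) = Fintype.card K * Fintype.card {x : R // φ x = 0} := by
    rw [Nat.card_congr e, Nat.card_prod]
    simp
  set M : ℝ := ((Fintype.card {x : R // φ x = 0} : ℕ) : ℝ) with hM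
  have hMpos : 0 < M := by
    have : Nonempty {x : R // φ x = 0} := ⟨⟨0, map_zero φ⟩⟩
    rw [hM]
    exact_mod_cast Fintype.card_pos
  rw [Nat.card_eq_fintype_card]
  refine le_trans ?_ hmain
  unfold GG
  rw [finsum_eq_sum_of_fintype]
  have hpt : ∀ k : R, (Nat.card R : ℝ) / cnt R k ≤ (1 / M) * ((Fintype.card K : ℝ) / n (φ k)) := by
    intro k
    have hc := fiber_count φ hφ hloc h3 k
    rw [Nat.card_eq_fintype_card, Fintype.card_subtype, Nat.card_eq_fintype_card] at hc
    have hc' : (n (φ k) : ℝ) * M ^ 2 ≤ cnt R k := by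
      rw [hM]
      exact_mod_cast hc
    rcases Nat.eq_zero_or_pos (n (φ k)) with h0 | h0
    · have hz : cnt R k = 0 := by
        have hk : φ k ≠ 0 := by
          intro hk
          rw [hn] at h0
          simp only [Finset.card_eq_zero] at h0
          have : ((1, -1, 0) : K × K × K) ∈ (Finset.univ.filter fun v : K × K × K =>
              v ≠ 0 ∧ v.1 ^ 3 + v.2.1 ^ 3 + v.2.2 ^ 3 = φ k) := by
            simp [hk]
            ring
          rw [h0] at this
          simp at this
        unfold cnt
        rw [Nat.card_eq_zero]
        left
        constructor
        rintro ⟨v, hv⟩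
        rw [hn] at h0
        simp only [Finset.card_eq_zero] at h0
        have hv2 : (φ v.1) ^ 3 + (φ v.2.1) ^ 3 + (φ v.2.2) ^ 3 = φ k := by
          rw [← hv]; simp
        have : (φ v.1, φ v.2.1, φ v.2.2) ∈ (Finset.univ.filter fun v : K × K × K =>
              v ≠ 0 ∧ v.1 ^ 3 + v.2.1 ^ 3 + v.2.2 ^ 3 = φ k) := by
          simp only [Finset.mem_filter, Finset.mem_univ, true_and]
          refine ⟨?_, hv2⟩
          intro h
          simp only [Prod.mk_eq_zero] at h
          rw [h.1, h.2.1, h.2.2] at hv2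
          apply hk
          rw [← hv2]
          simp
        rw [h0] at this
        simp at this
      rw [hz, h0]
      simp
    · have h0' : (0 : ℝ) < n (φ k) := by exact_mod_cast h0
      have hpos : (0 : ℝ) < n (φ k) * M ^ 2 := by positivity
      refine (div_le_div_of_nonneg_left (by positivity) hpos hc').trans (le_of_eq ?_)
      rw [hcard]
      field_simp
  refine (Finset.sum_le_sum fun k _ => hpt k).trans (le_of_eq ?_)
  rw [Fintype.sum_equiv e (fun k => (1 / M) * ((Fintype.card K : ℝ) / n (φ k)))
    (fun p => (1 / M) * ((Fintype.card K : ℝ) / n p.1)) (fun x => rfl)]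
  rw [Fintype.sum_prod_type]
  simp only [Finset.sum_const, Finset.card_univ, nsmul_eq_mul]
  rw [← hM]
  refine Finset.sum_congr rfl fun κ _ => ?_
  field_simp

end LocalPart

section GlobalPart

lemma cnt_congr {R S : Type} [CommRing R] [CommRing S] (e : R ≃+* S) (k : R) :
    cnt S (e k) = cnt R k := by
  unfold cnt
  refine (Nat.card_congr ?_).symm
  refine Equiv.subtypeEquiv (e.toEquiv.prodCongr (e.toEquiv.prodCongr e.toEquiv)) ?_
  rintro ⟨x, y, z⟩
  simp [← map_pow, ← map_add]

lemma GG_congr {R S : Type} [CommRing R] [CommRing S] (e : R ≃+* S) : GG R = GG S := by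
  unfold GG
  rw [Nat.card_congr e.toEquiv]
  exact finsum_eq_of_bijective e e.bijective (fun k => by rw [cnt_congr])

lemma cnt_prod {R S : Type} [CommRing R] [CommRing S] (k : R × S) :
    cnt (R × S) k = cnt R k.1 * cnt S k.2 := by
  unfold cnt
  rw [← Nat.card_prod]
  refine Nat.card_congr
    { toFun := fun v => (⟨(v.1.1.1, v.1.2.1.1, v.1.2.2.1), ?_⟩, ⟨(v.1.1.2, v.1.2.1.2, v.1.2.2.2), ?_⟩)
      invFun := fun w => ⟨((w.1.1.1, w.2.1.1), (w.1.1.2.1, w.2.1.2.1), (w.1.1.2.2, w.2.1.2.2)), ?_⟩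
      left_inv := fun v => rfl
      right_inv := fun v => rfl }
  · exact congrArg Prod.fst v.2
  · exact congrArg Prod.snd v.2
  · exact Prod.ext w.1.2 w.2.2

lemma GG_prod {R S : Type} [CommRing R] [CommRing S] [Finite R] [Finite S] :
    GG (R × S) = GG R * GG S := by
  have := Fintype.ofFinite R
  have := Fintype.ofFinite S
  unfold GG
  rw [finsum_eq_sum_of_fintype, finsum_eq_sum_of_fintype, finsum_eq_sum_of_fintype,
    Finset.sum_mul_sum, Fintype.sum_prod_type]
  refine Finset.sum_congr rfl fun x _ => Finset.sum_congr rfl fun y _ => ?_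
  rw [cnt_prod, Nat.card_prod]
  push_cast
  rw [div_mul_div_comm]

lemma GG_subsingleton {R : Type} [CommRing R] [Subsingleton R] : GG R = 1 := by
  have : Unique R := ⟨⟨0⟩, fun _ => Subsingleton.elim _ _⟩
  have h : cnt R default = 1 := by
    unfold cnt
    rw [Nat.card_eq_one_iff_unique]
    exact ⟨inferInstance, ⟨⟨0, Subsingleton.elim _ _⟩⟩⟩
  unfold GG
  rw [finsum_unique, h]
  simp

lemma GG_nonneg {R : Type} [CommRing R] : 0 ≤ GG R :=
  finsum_nonneg fun _ => by positivity

variable {Fq : Type} [Field Fq] [Fintype Fq]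

lemma moduleFinite_quot {N : Fq[X]} (hN : N ≠ 0) : Module.Finite Fq (Fq[X] ⧸ Ideal.span {N}) :=
  (AdjoinRoot.powerBasis hN).finite

lemma finite_quot {N : Fq[X]} (hN : N ≠ 0) : Finite (Fq[X] ⧸ Ideal.span {N}) :=
  have := moduleFinite_quot hN
  Module.finite_of_finite Fq

lemma card_quot {N : Fq[X]} (hN : N ≠ 0) :
    Nat.card (Fq[X] ⧸ Ideal.span {N}) = Fintype.card Fq ^ N.natDegree := by
  have := moduleFinite_quot hN
  rw [Module.natCard_eq_pow_finrank (K := Fq), finrank_quotient_span_eq_natDegree,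
    Nat.card_eq_fintype_card]

lemma GG_prime_pow (h3 : (3 : Fq) ≠ 0) {p : Fq[X]} (hp : Prime p) (i : ℕ) (hi : i ≠ 0) :
    GG (Fq[X] ⧸ Ideal.span {p ^ i}) ≤ 1 + 1200 ^ 4 / ((Fintype.card Fq : ℝ) ^ p.natDegree) ^ 2 := by
  have := finite_quot (pow_ne_zero i hp.ne_zero)
  have hmax : (Ideal.span {p}).IsMaximal :=
    PrincipalIdealRing.isMaximal_of_irreducible hp.irreducible
  let _ : Field (Fq[X] ⧸ Ideal.span {p}) := Ideal.Quotient.field _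
  have hle : Ideal.span {p ^ i} ≤ Ideal.span {p} := by
    rw [Ideal.span_singleton_le_span_singleton]
    exact dvd_pow_self p hi
  have h := local_bound (Ideal.Quotient.factor hle) (Ideal.Quotient.factor_surjective hle) ?_ ?_
  · rw [card_quot hp.ne_zero] at h
    push_cast at h
    exact h
  · intro x hx
    obtain ⟨f, rfl⟩ := Ideal.Quotient.mk_surjective x
    rw [Ideal.Quotient.factor_mk, Ne, Ideal.Quotient.eq_zero_iff_mem,
      Ideal.mem_span_singleton] at hx
    have hc : IsCoprime (p ^ i) f := ((hp.irreducible.coprime_iff_not_dvd).2 hx).pow_left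
    obtain ⟨a, b, hab⟩ := hc
    refine IsUnit.of_mul_eq_one (Ideal.Quotient.mk _ b) ?_
    rw [← map_mul, ← map_one (Ideal.Quotient.mk _), Ideal.Quotient.eq, Ideal.mem_span_singleton]
    exact ⟨-a, by linear_combination hab⟩
  · have : ((algebraMap Fq (Fq[X] ⧸ Ideal.span {p})) 3) ≠ 0 := by
      rw [Ne, map_eq_zero]
      exact h3
    rwa [map_ofNat] at this

open UniqueFactorizationMonoid in
lemma GG_le_prod [DecidableEq Fq] (h3 : (3 : Fq) ≠ 0) (N : Fq[X]) :
    N ≠ 0 → GG (Fq[X] ⧸ Ideal.span {N}) ≤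
      ∏ p ∈ (normalizedFactors N).toFinset,
        (1 + 1200 ^ 4 / ((Fintype.card Fq : ℝ) ^ p.natDegree) ^ 2) := by
  have hone : ∀ x : Fq[X], IsUnit x → GG (Fq[X] ⧸ Ideal.span {x}) ≤
      ∏ p ∈ (normalizedFactors x).toFinset,
        (1 + 1200 ^ 4 / ((Fintype.card Fq : ℝ) ^ p.natDegree) ^ 2) := by
    intro x hx
    have : Subsingleton (Fq[X] ⧸ Ideal.span {x}) := by
      rw [Ideal.Quotient.subsingleton_iff, Ideal.span_singleton_eq_top]
      exact hx
    rw [GG_subsingleton, normalizedFactors_of_isUnit hx]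
    simp
  induction N using induction_on_coprime with
  | h0 => intro h; exact absurd rfl h
  | h1 hx => intro _; exact hone _ hx
  | @hpr p i hp =>
    intro _
    rcases eq_or_ne i 0 with rfl | hi
    · exact hone _ (by simp)
    · refine (GG_prime_pow h3 hp i hi).trans (le_of_eq ?_)
      rw [hp.irreducible.normalizedFactors_pow, Multiset.toFinset_replicate, if_neg hi,
        Finset.prod_singleton]
      congr 4
      exact (Polynomial.natDegree_eq_of_degree_eq degree_normalize).symm
  | @hcp x y hxy hx hy =>
    intro h
    have hx0 := left_ne_zero_of_mul h
    have hy0 := right_ne_zero_of_mul h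
    have := finite_quot hx0
    have := finite_quot hy0
    have hcop : IsCoprime (Ideal.span {x}) (Ideal.span {y}) :=
      (Ideal.isCoprime_span_singleton_iff x y).2 hxy.isCoprime
    have e1 : GG (Fq[X] ⧸ Ideal.span {x * y}) =
        GG (Fq[X] ⧸ Ideal.span {x}) * GG (Fq[X] ⧸ Ideal.span {y}) := by
      rw [← GG_prod, ← Ideal.span_singleton_mul_span_singleton]
      exact GG_congr (Ideal.quotientMulEquivQuotientProd _ _ hcop)
    rw [e1, normalizedFactors_mul hx0 hy0, Multiset.toFinset_add, Finset.prod_union]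
    · exact mul_le_mul (hx hx0) (hy hy0) GG_nonneg
        (Finset.prod_nonneg fun _ _ => by positivity)
    · rw [Multiset.disjoint_toFinset]
      exact disjoint_normalizedFactors hxy

lemma sum_primes_le (s : Finset Fq[X]) (hs : ∀ p ∈ s, p.Monic ∧ 0 < p.natDegree) :
    ∑ p ∈ s, 1 / ((Fintype.card Fq : ℝ) ^ p.natDegree) ^ 2 ≤ 2 := by
  classical
  have hq := two_le_card (K := Fq)
  set q := (Fintype.card Fq : ℝ) with hqd
  set D := s.sup natDegree with hD
  rw [← Finset.sum_fiberwise_of_maps_to (t := Finset.range (D + 1)) (g := natDegree)]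
  · have h1 : ∀ d ∈ Finset.range (D + 1), ∑ p ∈ s with p.natDegree = d,
        1 / (q ^ p.natDegree) ^ 2 ≤ (1 / 2) ^ d := by
      intro d _
      have hcard : ((s.filter fun p => p.natDegree = d).card : ℝ) ≤ q ^ d := by
        have : (s.filter fun p => p.natDegree = d).card ≤
            (Finset.univ : Finset (Fin d → Fq)).card := by
          refine Finset.card_le_card_of_injOn (fun p i => p.coeff i) (fun _ _ => by simp) ?_
          intro p hp r hr h
          simp only [Finset.coe_filter, Set.mem_ofPred_eq] at hp hr
          ext n
          rcases lt_trichotomy n d with hn | hn | hn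
          · exact congrFun h ⟨n, hn⟩
          · have e1 := (hs p hp.1).1.coeff_natDegree
            have e2 := (hs r hr.1).1.coeff_natDegree
            rw [hp.2] at e1
            rw [hr.2] at e2
            rw [hn, e1, e2]
          · rw [coeff_eq_zero_of_natDegree_lt (by omega), coeff_eq_zero_of_natDegree_lt (by omega)]
        rw [Finset.card_univ, Fintype.card_fun, Fintype.card_fin] at this
        rw [hqd]
        exact_mod_cast this
      rw [Finset.sum_congr rfl (g := fun _ => 1 / (q ^ d) ^ 2)]
      · rw [Finset.sum_const, nsmul_eq_mul]
        calc _ ≤ q ^ d * (1 / (q ^ d) ^ 2) := by gcongr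
          _ = (1 / q) ^ d := by rw [one_div_pow]; field_simp
          _ ≤ (1 / 2) ^ d := by gcongr
      · intro p hp
        rw [(Finset.mem_filter.1 hp).2]
    refine (Finset.sum_le_sum h1).trans ?_
    exact sum_geometric_two_le _
  · intro p hp
    rw [Finset.mem_range]
    exact Nat.lt_succ_of_le (Finset.le_sup (f := natDegree) hp)

open UniqueFactorizationMonoid in
lemma GG_le (h3 : (3 : Fq) ≠ 0) (N : Fq[X]) (hN : N ≠ 0) :
    GG (Fq[X] ⧸ Ideal.span {N}) ≤ Real.exp (1200 ^ 4 * 2) := by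
  classical
  refine (GG_le_prod h3 N hN).trans ?_
  have h1 : ∀ p ∈ (normalizedFactors N).toFinset,
      (1 + 1200 ^ 4 / ((Fintype.card Fq : ℝ) ^ p.natDegree) ^ 2) ≤
      Real.exp (1200 ^ 4 * (1 / ((Fintype.card Fq : ℝ) ^ p.natDegree) ^ 2)) := by
    intro p _
    rw [mul_one_div, add_comm]
    exact Real.add_one_le_exp _
  refine (Finset.prod_le_prod (fun _ _ => by positivity) h1).trans ?_
  rw [← Real.exp_sum, ← Finset.mul_sum]
  apply Real.exp_le_exp.2
  refine mul_le_mul_of_nonneg_left ?_ (by positivity)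
  apply sum_primes_le
  intro p hp
  rw [Multiset.mem_toFinset] at hp
  have hi := irreducible_of_normalized_factor p hp
  refine ⟨?_, hi.natDegree_pos⟩
  rw [← normalize_normalized_factor p hp]
  exact monic_normalize hi.ne_zero

end GlobalPart

theorem sum_inv_rhoTilde_le :
    ∃ C : ℝ, 0 < C ∧ ∀ (Fq : Type) [Field Fq] [Fintype Fq], ringChar Fq ≠ 3 →
      ∀ N : Polynomial Fq, N.Monic →
        ∑ v : Fin N.natDegree → Fq,
            1 / rhoTilde Fq N (∑ i : Fin N.natDegree, Polynomial.C (v i) * X ^ (i : ℕ)) ≤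
          C * (Fintype.card Fq : ℝ) ^ N.natDegree := by
  refine ⟨Real.exp (1200 ^ 4 * 2), Real.exp_pos _, ?_⟩
  intro Fq _ _ hchar N hN
  have h3 : (3 : Fq) ≠ 0 := by
    intro h
    apply hchar
    have hdvd : ringChar Fq ∣ 3 := ringChar.dvd (by exact_mod_cast h)
    rcases (Nat.dvd_prime Nat.prime_three).1 hdvd with h1 | h1
    · exact absurd h1 CharP.ringChar_ne_one
    · exact h1
  have hN0 := hN.ne_zero
  have hfin := finite_quot hN0
  have := Fintype.ofFinite (Fq[X] ⧸ Ideal.span {N})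
  have hG := GG_le h3 N hN0
  unfold GG at hG
  rw [finsum_eq_sum_of_fintype] at hG
  have hq := two_le_card (K := Fq)
  set Q : ℝ := (Fintype.card Fq : ℝ) ^ N.natDegree with hQ
  have hQpos : 0 < Q := by positivity
  have hcard : (Nat.card (Fq[X] ⧸ Ideal.span {N}) : ℝ) = Q := by
    rw [card_quot hN0, hQ]; push_cast; rfl
  rw [hcard] at hG
  set poly : (Fin N.natDegree → Fq) → Fq[X] :=
    fun v => ∑ i : Fin N.natDegree, Polynomial.C (v i) * X ^ (i : ℕ) with hpoly
  have hterm : ∀ v, 1 / rhoTilde Fq N (poly v) =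
      Q * (Q / cnt _ (Ideal.Quotient.mk (Ideal.span {N}) (poly v))) := by
    intro v
    unfold rhoTilde cnt
    rw [← hQ, one_div_div]
    ring
  change ∑ v, 1 / rhoTilde Fq N (poly v) ≤ _
  simp_rw [hterm]
  rw [← Finset.mul_sum, mul_comm]
  refine mul_le_mul_of_nonneg_right (le_trans ?_ hG) hQpos.le
  have hinj : Function.Injective fun v => Ideal.Quotient.mk (Ideal.span {N}) (poly v) := by
    intro v w h
    have hdeg : ∀ v, (poly v).degree < N.degree := by
      intro v
      rw [degree_eq_natDegree hN0]
      refine (degree_sum_le _ _).trans_lt ?_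
      rw [Finset.sup_lt_iff (WithBot.bot_lt_coe _)]
      intro i _
      refine (degree_C_mul_X_pow_le _ _).trans_lt ?_
      exact_mod_cast i.2
    have hvw : poly v = poly w := by
      rw [Ideal.Quotient.eq, Ideal.mem_span_singleton] at h
      refine sub_eq_zero.1 (eq_zero_of_dvd_of_degree_lt h ?_)
      exact (degree_sub_le _ _).trans_lt (max_lt (hdeg v) (hdeg w))
    funext i
    have hc : ∀ v, (poly v).coeff i = v i := by
      intro v
      simp only [hpoly, finsetSum_coeff, coeff_C_mul, coeff_X_pow]
      rw [Finset.sum_eq_single i]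
      · simp
      · intro j _ hj
        rw [if_neg, mul_zero]
        exact fun h => hj (Fin.ext h.symm)
      · simp
    rw [← hc v, hvw, hc w]
  classical
  rw [← Finset.sum_image (s := Finset.univ)
    (g := fun v => Ideal.Quotient.mk (Ideal.span {N}) (poly v))
    (f := fun k => Q / cnt _ k) (fun _ _ _ _ h => hinj h)]
  exact Finset.sum_le_sum_of_subset_of_nonneg (Finset.subset_univ _)
    (fun _ _ _ => by positivity)
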